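/- Let x_1, …, x_6 be complex roots of unity, none equal to 1, none equal to −1, and such that no two of them sum to 0 (x_i + x_j ≠ 0 for all i ≠ j). If x_1 + ⋯ + x_6 = 2, then the multiset {x_1, …, x_6} equals the multiset {ζ_6, ζ_6⁵, ζ_10, ζ_10³, ζ_10⁷, ζ_10⁹}. -/

import Mathlib

/-- `zeta k = exp(2πi/k)`, the standard primitive `k`-th root of unity. -/
noncomputable def zeta (k : ℕ) : ℂ := Complex.exp (2 * Real.pi * Complex.I / k)

open Polynomial in
lemma nextCoeff_X_pow_sub_one (n : ℕ) (hn : 0 < n) :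
    (X ^ n - 1 : ℤ[X]).nextCoeff = if n = 1 then -1 else 0 := by
  have hd : (X ^ n - 1 : ℤ[X]).natDegree = n := by
    have := natDegree_X_pow_sub_C (R := ℤ) (n := n) (r := 1)
    simpa using this
  rw [nextCoeff_of_natDegree_pos (by omega), hd, coeff_sub, coeff_X_pow, coeff_one]
  have : n - 1 ≠ n := by omega
  by_cases h : n = 1
  · subst h; simp
  · have h2 : n - 1 ≠ 0 := by omega
    simp [h, h2, this]

open Polynomial in
lemma nextCoeff_cyclotomic (n : ℕ) (hn : 0 < n) :
    (cyclotomic n ℤ).nextCoeff = - ArithmeticFunction.moebius n := by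
  have h1 : ∀ n > 0, ∑ i ∈ n.divisors, (cyclotomic i ℤ).nextCoeff = if n = 1 then (-1 : ℤ) else 0 := by
    intro n hn
    rw [← nextCoeff_X_pow_sub_one n hn, ← prod_cyclotomic_eq_X_pow_sub_one hn,
      Monic.nextCoeff_prod]
    intro i _
    exact cyclotomic.monic i ℤ
  have h2 := (ArithmeticFunction.sum_eq_iff_sum_smul_moebius_eq.1 h1) n hn
  rw [← h2, Finset.sum_eq_single (n, 1)]
  · simp
  · rintro ⟨a, b⟩ hab hne
    have hb : b ≠ 1 := by
      rintro rfl
      simp at hab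
      exact hne (by simp [hab.1])
    simp [hb]
  · intro h; simp at h; omega

open Polynomial in
lemma exists_T (N : ℕ) (hN : 0 < N) : ∃ T : ℂ →ₗ[ℚ] ℚ, ∀ n, ∀ z : ℂ, n ∣ N →
    IsPrimitiveRoot z n → T z = (ArithmeticFunction.moebius n : ℚ) / (Nat.totient n : ℚ) := by
  let S : Set ℂ := {z | z ^ N = 1}
  have hS : S.Finite := by
    refine (Polynomial.nthRootsFinset N (1:ℂ)).finite_toSet.subset ?_
    intro z hz
    simp only [Finset.mem_coe]
    exact (Polynomial.mem_nthRootsFinset hN 1).2 hz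
  let L := IntermediateField.adjoin ℚ S
  have : Finite S := hS
  have : FiniteDimensional ℚ L := by
    apply IntermediateField.finiteDimensional_adjoin
    intro z hz
    exact IsIntegral.of_pow hN (by rw [show z ^ N = 1 from hz]; exact isIntegral_one)
  let T0 : L →ₗ[ℚ] ℚ := ((Module.finrank ℚ L : ℚ)⁻¹) • Algebra.trace ℚ L
  obtain ⟨T, hT⟩ := LinearMap.exists_extend (p := L.toSubalgebra.toSubmodule) T0
  refine ⟨T, ?_⟩
  intro n z hn hz
  have hn0 : 0 < n := Nat.pos_of_dvd_of_pos hn hN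
  have hzS : z ∈ S := by
    obtain ⟨k, rfl⟩ := hn
    show z ^ (n * k) = 1
    rw [pow_mul, hz.pow_eq_one, one_pow]
  let z' : L := ⟨z, IntermediateField.subset_adjoin ℚ S hzS⟩
  have hz' : IsPrimitiveRoot z' n := by
    apply IsPrimitiveRoot.of_map_of_injective (f := algebraMap L ℂ) _ (algebraMap L ℂ).injective
    exact hz
  have e : T z = T0 z' := by
    have := LinearMap.congr_fun hT z'
    exact this
  rw [e]
  show (Module.finrank ℚ L : ℚ)⁻¹ * Algebra.trace ℚ L z' = _
  have hm : minpoly ℚ z' = cyclotomic n ℚ := (cyclotomic_eq_minpoly_rat hz' hn0).symm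
  have hnc : (cyclotomic n ℚ).nextCoeff = - (ArithmeticFunction.moebius n : ℚ) := by
    rw [← map_cyclotomic_int, nextCoeff_map (Int.cast_injective : Function.Injective (Int.castRingHom ℚ)), nextCoeff_cyclotomic n hn0]
    simp
  rw [trace_eq_finrank_mul_minpoly_nextCoeff, hm, hnc]
  have hf : (Module.finrank ℚ L) = Nat.totient n * Module.finrank (IntermediateField.adjoin ℚ {z'}) L := by
    rw [← Module.finrank_mul_finrank ℚ (IntermediateField.adjoin ℚ {z'}) L,
      IntermediateField.adjoin.finrank (Algebra.IsIntegral.isIntegral z'), hm, natDegree_cyclotomic]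
  rw [hf]
  have h1 : (Nat.totient n : ℚ) ≠ 0 := by
    have := Nat.totient_pos.2 hn0
    positivity
  have h2 : (Module.finrank (IntermediateField.adjoin ℚ {z'}) L : ℚ) ≠ 0 := by
    have : 0 < Module.finrank (IntermediateField.adjoin ℚ {z'}) L := Module.finrank_pos
    positivity
  push_cast
  field_simp

lemma mu_phi (n : ℕ) (hn : 0 < n) (h1 : n ≠ 1) (h6 : n ≠ 6) :
    (ArithmeticFunction.moebius n : ℚ) / (Nat.totient n : ℚ) ≤ 1/4 ∧
    (n ≠ 10 → (ArithmeticFunction.moebius n : ℚ) / (Nat.totient n : ℚ) < 1/4) := by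
  have hp : (0:ℚ) < Nat.totient n := by
    have := Nat.totient_pos.2 hn
    positivity
  by_cases hsq : Squarefree n
  swap
  · rw [ArithmeticFunction.moebius_eq_zero_of_not_squarefree hsq]; norm_num
  by_cases h4 : Nat.totient n ≤ 4
  swap
  · have h5 : (5:ℚ) ≤ Nat.totient n := by exact_mod_cast (by omega : 5 ≤ Nat.totient n)
    have : (ArithmeticFunction.moebius n : ℚ) ≤ 1 := by
      have := ArithmeticFunction.moebius_eq_or n
      exact_mod_cast (by omega : ArithmeticFunction.moebius n ≤ 1)
    have : (ArithmeticFunction.moebius n : ℚ) / (Nat.totient n : ℚ) < 1/4 := by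
      rw [div_lt_iff₀ hp]; linarith
    exact ⟨this.le, fun _ => this⟩
  have hdvd : n ∣ 30 := by
    rw [← Nat.prod_primeFactors_of_squarefree hsq]
    have : n.primeFactors ⊆ ({2,3,5} : Finset ℕ) := by
      intro p hp
      have hpp := Nat.prime_of_mem_primeFactors hp
      have h := Nat.totient_dvd_of_dvd (Nat.dvd_of_mem_primeFactors hp)
      rw [Nat.totient_prime hpp] at h
      have := Nat.le_of_dvd (Nat.totient_pos.2 hn) h
      have : p ≤ 5 := by omega
      interval_cases p <;> first | (exfalso; revert hpp; norm_num; done) | simp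
    have h := Finset.prod_dvd_prod_of_subset n.primeFactors {2,3,5} (fun p => p) this
    simpa using h
  have hmem : n ∈ Nat.divisors 30 := by simp [hdvd]
  rw [show Nat.divisors 30 = {1,2,3,5,6,10,15,30} by decide] at hmem
  have m2 : ArithmeticFunction.moebius 2 = -1 := ArithmeticFunction.moebius_apply_prime (by norm_num)
  have m3 : ArithmeticFunction.moebius 3 = -1 := ArithmeticFunction.moebius_apply_prime (by norm_num)
  have m5 : ArithmeticFunction.moebius 5 = -1 := ArithmeticFunction.moebius_apply_prime (by norm_num)
  have m10 : ArithmeticFunction.moebius 10 = 1 := by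
    rw [show 10 = 2 * 5 by norm_num, ArithmeticFunction.isMultiplicative_moebius.map_mul_of_coprime (by norm_num), m2, m5]; norm_num
  have t2 : Nat.totient 2 = 1 := by decide
  have t3 : Nat.totient 3 = 2 := by decide
  have t5 : Nat.totient 5 = 4 := by decide
  have t10 : Nat.totient 10 = 4 := by decide
  have t15 : Nat.totient 15 = 8 := by decide
  have t30 : Nat.totient 30 = 8 := by decide
  simp only [Finset.mem_insert, Finset.mem_singleton] at hmem
  rcases hmem with rfl | rfl | rfl | rfl | rfl | rfl | rfl | rfl <;> simp_all <;> norm_num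

lemma mu_phi_vals : ((ArithmeticFunction.moebius 6 : ℚ) / (Nat.totient 6 : ℚ) = 1/2) ∧
   ((ArithmeticFunction.moebius 3 : ℚ) / (Nat.totient 3 : ℚ) = -1/2) ∧
   ((ArithmeticFunction.moebius 5 : ℚ) / (Nat.totient 5 : ℚ) = -1/4) ∧
   ((ArithmeticFunction.moebius 10 : ℚ) / (Nat.totient 10 : ℚ) = 1/4) := by
  have m2 : ArithmeticFunction.moebius 2 = -1 := ArithmeticFunction.moebius_apply_prime (by norm_num)
  have m3 : ArithmeticFunction.moebius 3 = -1 := ArithmeticFunction.moebius_apply_prime (by norm_num)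
  have m5 : ArithmeticFunction.moebius 5 = -1 := ArithmeticFunction.moebius_apply_prime (by norm_num)
  have m10 : ArithmeticFunction.moebius 10 = 1 := by
    rw [show 10 = 2 * 5 by norm_num, ArithmeticFunction.isMultiplicative_moebius.map_mul_of_coprime (by norm_num), m2, m5]; norm_num
  have m6 : ArithmeticFunction.moebius 6 = 1 := by
    rw [show 6 = 2 * 3 by norm_num, ArithmeticFunction.isMultiplicative_moebius.map_mul_of_coprime (by norm_num), m2, m3]; norm_num
  rw [m6, m3, m5, m10, show Nat.totient 6 = 2 by decide, show Nat.totient 3 = 2 by decide,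
    show Nat.totient 5 = 4 by decide, show Nat.totient 10 = 4 by decide]
  norm_num

/-- The properties of the normalized trace on `N`-th roots of unity that are used below. -/
structure GoodT (N : ℕ) (T : ℂ →ₗ[ℚ] ℚ) : Prop where
  one : T 1 = 1
  six : ∀ z, IsPrimitiveRoot z 6 → T z = 1/2
  three : ∀ z, IsPrimitiveRoot z 3 → T z = -1/2
  five : ∀ z, IsPrimitiveRoot z 5 → T z = -1/4
  ten : ∀ z, IsPrimitiveRoot z 10 → T z = 1/4
  le : ∀ z, z ^ N = 1 → z ≠ 1 → ¬ IsPrimitiveRoot z 6 → T z ≤ 1/4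
  eq : ∀ z, z ^ N = 1 → z ≠ 1 → ¬ IsPrimitiveRoot z 6 → T z = 1/4 → IsPrimitiveRoot z 10

lemma exists_good (N : ℕ) (hN : 0 < N) (h30 : 30 ∣ N) : ∃ T : ℂ →ₗ[ℚ] ℚ, GoodT N T := by
  obtain ⟨T, hT⟩ := exists_T N hN
  obtain ⟨v6, v3, v5, v10⟩ := mu_phi_vals
  refine ⟨T, ?_, ?_, ?_, ?_, ?_, ?_, ?_⟩
  · have := hT 1 1 (one_dvd _) IsPrimitiveRoot.one
    simpa using this
  · intro z hz; rw [hT 6 z (dvd_trans (by norm_num) h30) hz, v6]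
  · intro z hz; rw [hT 3 z (dvd_trans (by norm_num) h30) hz, v3]
  · intro z hz; rw [hT 5 z (dvd_trans (by norm_num) h30) hz, v5]
  · intro z hz; rw [hT 10 z (dvd_trans (by norm_num) h30) hz, v10]
  · intro z hz h1 h6
    have hd := orderOf_dvd_of_pow_eq_one hz
    have ho := IsPrimitiveRoot.orderOf z
    rw [hT _ z hd ho]
    refine (mu_phi _ (Nat.pos_of_dvd_of_pos hd hN) ?_ ?_).1
    · rwa [Ne, orderOf_eq_one_iff]
    · intro h; rw [h] at ho; exact h6 ho
  · intro z hz h1 h6 ht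
    have hd := orderOf_dvd_of_pow_eq_one hz
    have ho := IsPrimitiveRoot.orderOf z
    rw [hT _ z hd ho] at ht
    by_contra h10
    have := (mu_phi _ (Nat.pos_of_dvd_of_pos hd hN) (by rwa [Ne, orderOf_eq_one_iff])
      (by intro h; rw [h] at ho; exact h6 ho)).2 (by intro h; rw [h] at ho; exact h10 ho)
    linarith

lemma three_units (x y z v : ℂ) (hx : ‖x‖ = 1) (hy : ‖y‖ = 1) (hz : ‖z‖ = 1) (hv : ‖v‖ = 1)
    (h : x + y + z = v) : (x + y) * (y + z) * (z + x) = 0 := by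
  have h' := congrArg (starRingEnd ℂ) h
  simp only [map_add] at h'
  rw [← Complex.inv_eq_conj hx, ← Complex.inv_eq_conj hy, ← Complex.inv_eq_conj hz,
    ← Complex.inv_eq_conj hv] at h'
  have x0 : x ≠ 0 := by rintro rfl; simp at hx
  have y0 : y ≠ 0 := by rintro rfl; simp at hy
  have z0 : z ≠ 0 := by rintro rfl; simp at hz
  have v0 : v ≠ 0 := by rintro rfl; simp at hv
  have h3 : (x + y + z) * (x⁻¹ + y⁻¹ + z⁻¹) = 1 := by
    rw [h, h']; field_simp
  field_simp at h3
  linear_combination h3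

lemma prim6 (u v z : ℂ) (hu : IsPrimitiveRoot u 6) (huv : u + v = 1) (huv' : u * v = 1)
    (hz : IsPrimitiveRoot z 6) : z = u ∨ z = v := by
  have key : ∀ z : ℂ, IsPrimitiveRoot z 6 → z ^ 2 - z + 1 = 0 := by
    intro z hz
    have h1 : z ^ 3 ≠ 1 := hz.pow_ne_one_of_pos_of_lt (by norm_num) (by norm_num)
    have h2 : z ^ 2 ≠ 1 := hz.pow_ne_one_of_pos_of_lt (by norm_num) (by norm_num)
    have h3 : (z ^ 3 - 1) * ((z + 1) * (z ^ 2 - z + 1)) = 0 := by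
      have := hz.pow_eq_one
      linear_combination this
    rcases mul_eq_zero.1 h3 with h | h
    · exact absurd (sub_eq_zero.1 h) h1
    rcases mul_eq_zero.1 h with h | h
    · exact absurd (by linear_combination (z - 1) * h) h2
    · exact h
  have : (z - u) * (z - v) = 0 := by
    have := key z hz
    linear_combination this - z * huv + huv'
  rcases mul_eq_zero.1 this with h | h
  · exact Or.inl (sub_eq_zero.1 h)
  · exact Or.inr (sub_eq_zero.1 h)

/-- The hypotheses of the theorem, together with a normalized trace. -/
structure Setup (x : Fin 6 → ℂ) (N : ℕ) (T : ℂ →ₗ[ℚ] ℚ) (u v : ℂ) : Prop where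
  hN : 0 < N
  h30 : 30 ∣ N
  hT : GoodT N T
  hx : ∀ i, x i ^ N = 1
  hne1 : ∀ i, x i ≠ 1
  hpair : ∀ i j, i ≠ j → x i + x j ≠ 0
  hsum : ∑ i, x i = 2
  hu : IsPrimitiveRoot u 6
  hv : IsPrimitiveRoot v 6
  huv : u + v = 1
  huv' : u * v = 1

lemma Setup.symm {x N T u v} (h : Setup x N T u v) : Setup x N T v u :=
  { h with hu := h.hv, hv := h.hu, huv := by rw [add_comm, h.huv], huv' := by rw [mul_comm, h.huv'] }

lemma Setup.uv {x N T u v} (h : Setup x N T u v) : u ≠ v := by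
  intro e
  have h1 := h.huv'
  rw [← e] at h1
  have := h.hu.pow_ne_one_of_pos_of_lt (l := 2) (by norm_num) (by norm_num)
  exact this (by rw [pow_two, h1])

lemma Setup.uN {x N T u v} (h : Setup x N T u v) : u ^ N = 1 :=
  (h.hu.pow_eq_one_iff_dvd N).2 (dvd_trans (by norm_num) h.h30)

/-- number of indices with `x i = u` -/
noncomputable def cnt (x : Fin 6 → ℂ) (u : ℂ) : ℕ := (Finset.univ.filter (fun i => x i = u)).card

lemma cnt_sum (x : Fin 6 → ℂ) (u : ℂ) : ∑ i, (if x i = u then (1:ℚ) else 0) = cnt x u := by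
  simp [cnt]

lemma Setup.pt1 {x N T u v} (h : Setup x N T u v) (i : Fin 6) :
    T (x i) ≤ 1/4 + 1/4 * (if x i = u then 1 else 0) + 1/4 * (if x i = v then 1 else 0) := by
  have := h.uv
  by_cases h1 : x i = u
  · rw [h1, h.hT.six u h.hu]; simp [this]; norm_num
  by_cases h2 : x i = v
  · rw [h2, h.hT.six v h.hv]; simp [this.symm]; norm_num
  have := h.hT.le (x i) (h.hx i) (h.hne1 i) (fun h6 => by
    rcases prim6 u v _ h.hu h.huv h.huv' h6 with h | h
    · exact h1 h
    · exact h2 h)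
  simpa [h1, h2] using this

lemma Setup.total1 {x N T u v} (h : Setup x N T u v) : ∑ i, T (x i) = 2 := by
  rw [← map_sum, h.hsum, show (2:ℂ) = 1 + 1 by norm_num, map_add, h.hT.one]; norm_num

lemma Setup.totalm {x N T u v} (h : Setup x N T u v) (w : ℂ) : ∑ i, T (x i * w) = 2 * T w := by
  rw [← map_sum, ← Finset.sum_mul, h.hsum, two_mul, map_add, two_mul]

lemma Setup.ge2 {x N T u v} (h : Setup x N T u v) : 2 ≤ cnt x u + cnt x v := by
  have := Finset.sum_le_sum (fun i (_ : i ∈ Finset.univ) => h.pt1 i)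
  rw [h.total1, Finset.sum_add_distrib, Finset.sum_add_distrib, ← Finset.mul_sum, ← Finset.mul_sum,
    cnt_sum, cnt_sum] at this
  simp at this
  have : (2:ℚ) ≤ cnt x u + cnt x v := by linarith
  exact_mod_cast this

lemma Setup.v2 {x N T u v} (h : Setup x N T u v) : T (v * v) = -1/2 := by
  rw [← pow_two]
  exact h.hT.three _ (h.hv.pow (by norm_num) (by norm_num))

lemma Setup.pt2 {x N T u v} (h : Setup x N T u v) (i : Fin 6) :
    T (x i * v) ≤ 1/2 + 1/2 * (if x i = u then 1 else 0) - 1 * (if x i = v then 1 else 0) := by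
  have := h.uv
  by_cases h1 : x i = u
  · rw [h1, h.huv', h.hT.one]; simp [this]; norm_num
  by_cases h2 : x i = v
  · rw [h2, h.v2]; simp [this.symm]; norm_num
  have hne : x i * v ≠ 1 := by
    intro e
    apply h1
    calc x i = (x i * v) * u := by rw [mul_assoc, mul_comm v, h.huv', mul_one]
      _ = u := by rw [e, one_mul]
  have : T (x i * v) ≤ 1/2 := by
    by_cases h6 : IsPrimitiveRoot (x i * v) 6
    · rw [h.hT.six _ h6]
    · have := h.hT.le (x i * v) (by rw [mul_pow, h.hx, h.symm.uN, one_mul]) hne h6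
      linarith
  simpa [h1, h2] using this

lemma Setup.le2 {x N T u v} (h : Setup x N T u v) : 2 * cnt x v ≤ 4 + cnt x u := by
  have := Finset.sum_le_sum (fun i (_ : i ∈ Finset.univ) => h.pt2 i)
  rw [h.totalm, Finset.sum_sub_distrib, Finset.sum_add_distrib, ← Finset.mul_sum, ← Finset.mul_sum,
    cnt_sum, cnt_sum, h.hT.six v h.hv] at this
  simp at this
  have : (2:ℚ) * cnt x v ≤ 4 + cnt x u := by linarith
  exact_mod_cast this

lemma Setup.all10 {x N T u v} (h : Setup x N T u v) (h2 : cnt x u + cnt x v = 2) (i : Fin 6)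
    (h1 : x i ≠ u) (h2 : x i ≠ v) : IsPrimitiveRoot (x i) 10 := by
  have hs : ∑ i, T (x i) =
      ∑ i, (1/4 + 1/4 * (if x i = u then 1 else 0) + 1/4 * (if x i = v then (1:ℚ) else 0)) := by
    rw [h.total1, Finset.sum_add_distrib, Finset.sum_add_distrib, ← Finset.mul_sum,
      ← Finset.mul_sum, cnt_sum, cnt_sum]
    have : (cnt x u + cnt x v : ℚ) = 2 := by exact_mod_cast ‹cnt x u + cnt x v = 2›
    simp
    linarith
  have := (Finset.sum_eq_sum_iff_of_le (fun i _ => h.pt1 i)).1 hs i (Finset.mem_univ i)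
  apply h.hT.eq (x i) (h.hx i) (h.hne1 i)
  · intro h6
    rcases prim6 u v _ h.hu h.huv h.huv' h6 with h | h
    · exact h1 h
    · exact h2 h
  · simpa [h1, h2] using this

lemma Setup.not20 {x N T u v} (h : Setup x N T u v) (hu2 : cnt x u = 2) (hv0 : cnt x v = 0) :
    False := by
  have hv : ∀ i, x i ≠ v := by
    intro i hi
    have : i ∈ Finset.univ.filter (fun i => x i = v) := by simp [hi]
    rw [cnt, Finset.card_eq_zero] at hv0
    rw [hv0] at this
    simp at this
  have hp : ∀ i, T (x i * u) ≤ 1/4 - 3/4 * (if x i = u then 1 else 0) := by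
    intro i
    by_cases h1 : x i = u
    · rw [h1, h.symm.v2]; simp; norm_num
    have h10 := h.all10 (by omega) i h1 (hv i)
    have h6 : (x i * u) ^ 6 ≠ 1 := by
      rw [mul_pow, h.hu.pow_eq_one, mul_one]
      exact h10.pow_ne_one_of_pos_of_lt (by norm_num) (by norm_num)
    have := h.hT.le (x i * u) (by rw [mul_pow, h.hx, h.uN, one_mul])
      (fun e => h6 (by rw [e, one_pow])) (fun e => h6 e.pow_eq_one)
    simpa [h1] using this
  have := Finset.sum_le_sum (fun i (_ : i ∈ Finset.univ) => hp i)
  rw [h.totalm, Finset.sum_sub_distrib, ← Finset.mul_sum, cnt_sum, h.hT.six u h.hu, hu2] at this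
  norm_num at this

/-- indices with `x i` neither `u` nor `v` -/
noncomputable def rest (x : Fin 6 → ℂ) (u v : ℂ) : Finset (Fin 6) :=
  (Finset.univ.filter (fun i => ¬ x i = u)).filter (fun i => ¬ x i = v)

lemma Setup.filt {x N T u v} (h : Setup x N T u v) :
    (Finset.univ.filter (fun i => ¬ x i = u)).filter (fun i => x i = v) =
    Finset.univ.filter (fun i => x i = v) := by
  ext i
  have := h.uv
  simp only [Finset.mem_filter, Finset.mem_univ, true_and]
  constructor
  · exact fun h => h.2
  · intro h; exact ⟨by rw [h]; exact this.symm, h⟩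

lemma Setup.rest_card {x N T u v} (h : Setup x N T u v) :
    cnt x u + cnt x v + (rest x u v).card = 6 := by
  have h1 := Finset.card_filter_add_card_filter_not (s := (Finset.univ : Finset (Fin 6))) (fun i => x i = u)
  have h2 := Finset.card_filter_add_card_filter_not (s := Finset.univ.filter (fun i => ¬ x i = u)) (fun i => x i = v)
  rw [h.filt] at h2
  simp only [Finset.card_univ, Fintype.card_fin] at h1
  unfold rest cnt
  omega

lemma Setup.rest_sum {x N T u v} (h : Setup x N T u v) :
    cnt x u * u + cnt x v * v + ∑ i ∈ rest x u v, x i = 2 := by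
  have h1 := Finset.sum_filter_add_sum_filter_not (Finset.univ : Finset (Fin 6)) (fun i => x i = u) x
  have h2 := Finset.sum_filter_add_sum_filter_not (Finset.univ.filter (fun i => ¬ x i = u)) (fun i => x i = v) x
  rw [h.filt] at h2
  have e : ∀ w, ∑ i ∈ Finset.univ.filter (fun i => x i = w), x i = cnt x w * w := by
    intro w
    rw [Finset.sum_congr rfl (g := fun _ => w) (by intro i hi; exact (Finset.mem_filter.1 hi).2)]
    simp [cnt]
  rw [e, h.hsum] at h1
  rw [e] at h2
  unfold rest
  rw [← h1, ← h2]; ring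

lemma exists_of_cnt {x : Fin 6 → ℂ} {u : ℂ} (h : 0 < cnt x u) : ∃ i, x i = u := by
  obtain ⟨i, hi⟩ := Finset.card_pos.1 h
  exact ⟨i, (Finset.mem_filter.1 hi).2⟩

lemma Setup.norm {x N T u v} (h : Setup x N T u v) (i : Fin 6) : ‖x i‖ = 1 :=
  Complex.norm_eq_one_of_pow_eq_one (h.hx i) h.hN.ne'

lemma Setup.core {x N T u v} (h : Setup x N T u v) (hle : cnt x v ≤ cnt x u) :
    cnt x u = 1 ∧ cnt x v = 1 := by
  have h1 := h.ge2
  have h2 := h.symm.le2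
  have h3 := h.rest_card
  have hs := h.rest_sum
  have huv := h.huv
  have hcases : (cnt x u = 2 ∧ cnt x v = 0) ∨ (cnt x u = 1 ∧ cnt x v = 1) ∨
    (cnt x u = 2 ∧ cnt x v = 1) ∨ (cnt x u = 2 ∧ cnt x v = 2) ∨ (cnt x u = 3 ∧ cnt x v = 2) ∨
    (cnt x u = 3 ∧ cnt x v = 3) := by omega
  rcases hcases with ⟨a, b⟩ | ⟨a, b⟩ | ⟨a, b⟩ | ⟨a, b⟩ | ⟨a, b⟩ | ⟨a, b⟩
  · exact (h.not20 a b).elim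
  · exact ⟨a, b⟩
  · exfalso
    obtain ⟨i, j, k, hij, hik, hjk, e⟩ := Finset.card_eq_three.1 (by omega : (rest x u v).card = 3)
    rw [e, Finset.sum_insert (by simp [hij, hik]), Finset.sum_pair hjk, a, b] at hs
    have := three_units (x i) (x j) (x k) v (h.norm i) (h.norm j) (h.norm k)
      (Complex.norm_eq_one_of_pow_eq_one h.hv.pow_eq_one (by norm_num))
      (by push_cast at hs; linear_combination hs - 2 * huv)
    simp only [mul_eq_zero, h.hpair i j hij, h.hpair j k hjk, h.hpair k i hik.symm, or_self] at this
  · exfalso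
    obtain ⟨i, j, hij, e⟩ := Finset.card_eq_two.1 (by omega : (rest x u v).card = 2)
    rw [e, Finset.sum_pair hij, a, b] at hs
    exact h.hpair i j hij (by push_cast at hs; linear_combination hs - 2 * huv)
  · exfalso
    obtain ⟨i, e⟩ := Finset.card_eq_one.1 (by omega : (rest x u v).card = 1)
    have hi : i ∈ rest x u v := by rw [e]; simp
    rw [e, Finset.sum_singleton, a, b] at hs
    obtain ⟨j, hj⟩ := exists_of_cnt (x := x) (u := u) (by omega)
    simp only [rest, Finset.mem_filter, Finset.mem_univ, true_and] at hi
    refine h.hpair i j ?_ ?_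
    · rintro rfl; exact hi.1 hj
    · rw [hj]; push_cast at hs; linear_combination hs - 2 * huv
  · exfalso
    have e := Finset.card_eq_zero.1 (by omega : (rest x u v).card = 0)
    rw [e, Finset.sum_empty, a, b] at hs
    have : (1:ℂ) = 0 := by push_cast at hs; linear_combination hs - 3 * huv
    exact one_ne_zero this

lemma Setup.mem10 {x N T u v} (h : Setup x N T u v) (hu1 : cnt x u = 1) (hv1 : cnt x v = 1)
    (w : ℂ) (hw : IsPrimitiveRoot w 10) : ∃ i, x i = w := by
  by_contra hcon
  push Not at hcon
  have h3 := h.rest_card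
  have hs := h.rest_sum
  have huv := h.huv
  rw [hu1, hv1] at hs
  have hs1 : ∑ i ∈ rest x u v, x i = 1 := by push_cast at hs; linear_combination hs - huv
  have neg5 : ∀ z : ℂ, IsPrimitiveRoot z 10 → z ^ 5 = -1 := by
    intro z hz
    have h5 : z ^ 5 ≠ 1 := hz.pow_ne_one_of_pos_of_lt (by norm_num) (by norm_num)
    have : (z ^ 5 - 1) * (z ^ 5 + 1) = 0 := by linear_combination hz.pow_eq_one
    rcases mul_eq_zero.1 this with h | h
    · exact absurd (sub_eq_zero.1 h) h5
    · linear_combination h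
  have hwi : IsPrimitiveRoot (w⁻¹) 10 := hw.inv
  have w0 : w ≠ 0 := hw.ne_zero (by norm_num)
  have ht : ∑ i ∈ rest x u v, T (x i * w⁻¹) = 1/4 := by
    rw [← map_sum, ← Finset.sum_mul, hs1, one_mul, h.hT.ten _ hwi]
  have he : ∀ i ∈ rest x u v, T (x i * w⁻¹) = -1/4 := by
    intro i hi
    simp only [rest, Finset.mem_filter, Finset.mem_univ, true_and] at hi
    have h10 := h.all10 (by omega) i hi.1 hi.2
    apply h.hT.five
    have : Fact (Nat.Prime 5) := ⟨by norm_num⟩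
    have ho : orderOf (x i * w⁻¹) = 5 := by
      apply orderOf_eq_prime
      · rw [mul_pow, neg5 _ h10, neg5 _ hwi]; norm_num
      · intro e
        apply hcon i
        field_simp at e
        exact e
    rw [← ho]; exact IsPrimitiveRoot.orderOf _
  rw [Finset.sum_congr rfl he, Finset.sum_const, show (rest x u v).card = 4 by omega] at ht
  norm_num at ht


theorem stmt9 (x : Fin 6 → ℂ)
    (hroot : ∀ i, ∃ m : ℕ, 1 ≤ m ∧ x i ^ m = 1)
    (hne1 : ∀ i, x i ≠ 1)
    (hnem1 : ∀ i, x i ≠ -1)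
    (hpair : ∀ i j, i ≠ j → x i + x j ≠ 0)
    (hsum : ∑ i, x i = 2) :
    Finset.univ.val.map x =
      ({zeta 6, zeta 6 ^ 5, zeta 10, zeta 10 ^ 3, zeta 10 ^ 7, zeta 10 ^ 9} : Multiset ℂ) := by
  have h6 : IsPrimitiveRoot (zeta 6) 6 := Complex.isPrimitiveRoot_exp 6 (by norm_num)
  have h10 : IsPrimitiveRoot (zeta 10) 10 := Complex.isPrimitiveRoot_exp 10 (by norm_num)
  have h65 : IsPrimitiveRoot (zeta 6 ^ 5) 6 := h6.pow_of_coprime 5 (by norm_num)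
  have h103 : IsPrimitiveRoot (zeta 10 ^ 3) 10 := h10.pow_of_coprime 3 (by norm_num)
  have h107 : IsPrimitiveRoot (zeta 10 ^ 7) 10 := h10.pow_of_coprime 7 (by norm_num)
  have h109 : IsPrimitiveRoot (zeta 10 ^ 9) 10 := h10.pow_of_coprime 9 (by norm_num)
  choose m hm hxm using hroot
  have hN : 0 < 30 * ∏ i, m i := by
    have : 0 < ∏ i, m i := Finset.prod_pos (fun i _ => hm i)
    omega
  have h30 : 30 ∣ 30 * ∏ i, m i := dvd_mul_right _ _
  obtain ⟨T, hT⟩ := exists_good _ hN h30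
  have hmul : zeta 6 * zeta 6 ^ 5 = 1 := by rw [← pow_succ', h6.pow_eq_one]
  have hadd : zeta 6 + zeta 6 ^ 5 = 1 := by
    have h1 : zeta 6 ^ 3 ≠ 1 := h6.pow_ne_one_of_pos_of_lt (by norm_num) (by norm_num)
    have h2 : zeta 6 ^ 2 ≠ 1 := h6.pow_ne_one_of_pos_of_lt (by norm_num) (by norm_num)
    have h3 : (zeta 6 ^ 3 - 1) * ((zeta 6 + 1) * (zeta 6 ^ 2 - zeta 6 + 1)) = 0 := by
      linear_combination h6.pow_eq_one
    rcases mul_eq_zero.1 h3 with h | h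
    · exact absurd (sub_eq_zero.1 h) h1
    rcases mul_eq_zero.1 h with h | h
    · exact absurd (by linear_combination (zeta 6 - 1) * h) h2
    · linear_combination (zeta 6 ^ 3 + zeta 6 ^ 2 - 1) * h
  have S : Setup x _ T (zeta 6) (zeta 6 ^ 5) :=
    { hN := hN, h30 := h30, hT := hT, hne1 := hne1, hpair := hpair, hsum := hsum
      hu := h6, hv := h65, huv := hadd, huv' := hmul
      hx := by
        intro i
        obtain ⟨k, hk⟩ : m i ∣ 30 * ∏ i, m i :=
          dvd_mul_of_dvd_right (Finset.dvd_prod_of_mem m (Finset.mem_univ i)) _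
        rw [hk, pow_mul, hxm, one_pow] }
  have hc : cnt x (zeta 6) = 1 ∧ cnt x (zeta 6 ^ 5) = 1 := by
    rcases le_total (cnt x (zeta 6 ^ 5)) (cnt x (zeta 6)) with h | h
    · exact S.core h
    · exact (S.symm.core h).symm
  have hmem : ∀ w, IsPrimitiveRoot w 10 → w ∈ Finset.univ.val.map x := by
    intro w hw
    obtain ⟨i, hi⟩ := S.mem10 hc.1 hc.2 w hw
    exact Multiset.mem_map.2 ⟨i, Finset.mem_univ i, hi⟩
  have hmem6 : ∀ w, cnt x w = 1 → w ∈ Finset.univ.val.map x := by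
    intro w hw
    obtain ⟨i, hi⟩ := exists_of_cnt (x := x) (u := w) (by omega)
    exact Multiset.mem_map.2 ⟨i, Finset.mem_univ i, hi⟩
  have hne : ∀ a b : ℂ, IsPrimitiveRoot a 6 → IsPrimitiveRoot b 10 → a ≠ b := by
    rintro a b ha hb rfl
    have := ha.unique hb
    omega
  have hnp : ∀ a b : ℕ, a < 10 → b < 10 → a ≠ b → zeta 10 ^ a ≠ zeta 10 ^ b :=
    fun a b ha hb hab e => hab (h10.pow_inj ha hb e)
  have hnodup : ({zeta 6, zeta 6 ^ 5, zeta 10, zeta 10 ^ 3, zeta 10 ^ 7, zeta 10 ^ 9} :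
      Multiset ℂ).Nodup := by
    have n1 := hnp 1 3 (by norm_num) (by norm_num) (by norm_num)
    have n2 := hnp 1 7 (by norm_num) (by norm_num) (by norm_num)
    have n3 := hnp 1 9 (by norm_num) (by norm_num) (by norm_num)
    have n4 := hnp 3 7 (by norm_num) (by norm_num) (by norm_num)
    have n5 := hnp 3 9 (by norm_num) (by norm_num) (by norm_num)
    have n6 := hnp 7 9 (by norm_num) (by norm_num) (by norm_num)
    rw [pow_one] at n1 n2 n3
    simp only [Multiset.insert_eq_cons, Multiset.nodup_cons, Multiset.mem_cons,
      Multiset.mem_singleton, Multiset.nodup_singleton, not_or]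
    exact ⟨⟨S.uv, hne _ _ h6 h10, hne _ _ h6 h103, hne _ _ h6 h107, hne _ _ h6 h109⟩,
      ⟨hne _ _ h65 h10, hne _ _ h65 h103, hne _ _ h65 h107, hne _ _ h65 h109⟩,
      ⟨n1, n2, n3⟩, ⟨n4, n5⟩, n6, trivial⟩
  symm
  apply Multiset.eq_of_le_of_card_le
  · rw [Multiset.le_iff_subset hnodup]
    intro z hz
    simp only [Multiset.insert_eq_cons, Multiset.mem_cons, Multiset.mem_singleton] at hz
    rcases hz with rfl | rfl | rfl | rfl | rfl | rfl
    · exact hmem6 _ hc.1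
    · exact hmem6 _ hc.2
    · exact hmem _ h10
    · exact hmem _ h103
    · exact hmem _ h107
    · exact hmem _ h109
  · simp
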